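/- arXiv:2504.03443 — 4 statements merged into one kernel-verified Lean document; each statement's English description precedes it below -/
import Mathlib

section
/- Let φ : ℝᵐ → ℝᵐ be the saturation function defined componentwise by φᵢ(u) = sign(uᵢ)·min{|uᵢ|, 1}. Let K ∈ ℝ^{m×n} with rows Kᵢ, let e ∈ ℝⁿ, and let v ∈ ℝᵐ with ‖v‖_∞ ≤ 1. Then for every i ∈ {1,…,m}, the scalar φᵢ(Ke + v) − vᵢ lies between min{0, Kᵢe} and max{0, Kᵢe}; equivalently, φᵢ(Ke + v) − vᵢ belongs to the convex hull of {0, Kᵢe} in ℝ. -/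
open Matrix

/-- Componentwise saturation function: φᵢ(u) = sign(uᵢ)·min{|uᵢ|, 1}. -/
noncomputable def sat {m : ℕ} (u : Fin m → ℝ) : Fin m → ℝ :=
  fun i => Real.sign (u i) * min |u i| 1

theorem sign_mul_min_abs_one (x : ℝ) : Real.sign x * min |x| 1 = max (-1) (min x 1) := by
  rcases lt_trichotomy x 0 with h | rfl | h
  · rw [Real.sign_of_neg h, abs_of_neg h]
    grind
  · simp
  · rw [Real.sign_of_pos h, abs_of_pos h]
    grind

theorem clamp_add_sub_mem_uIcc {a b : ℝ} (hb : |b| ≤ 1) :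
    max (-1) (min (a + b) 1) - b ∈ Set.uIcc 0 a := by
  obtain ⟨h₁, h₂⟩ := abs_le.mp hb
  rw [Set.uIcc, Set.mem_Icc]
  grind

theorem saturation_component_in_hull {m n : ℕ}
    (K : Matrix (Fin m) (Fin n) ℝ) (e : Fin n → ℝ)
    (v : Fin m → ℝ) (hv : ∀ i, |v i| ≤ 1) (i : Fin m) :
    (min 0 (K.mulVec e i) ≤ sat (K.mulVec e + v) i - v i ∧
      sat (K.mulVec e + v) i - v i ≤ max 0 (K.mulVec e i)) ∧
    sat (K.mulVec e + v) i - v i ∈ convexHull ℝ ({0, K.mulVec e i} : Set ℝ) := by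
  have h : sat (K.mulVec e + v) i - v i ∈ Set.uIcc 0 (K.mulVec e i) := by
    rw [sat, sign_mul_min_abs_one, Pi.add_apply]
    exact clamp_add_sub_mem_uIcc (hv i)
  refine ⟨h, ?_⟩
  rwa [convexHull_pair, segment_eq_uIcc]
end

section
/- Let A ∈ ℝ^{n×n}, B ∈ ℝ^{n×m}, K ∈ ℝ^{m×n}, φ the componentwise saturation function, f(e, v) = Ae + B(φ(Ke + v) − v), and for J ⊆ {1,…,m} let M_J = A + Σ_{i∈J} B₍ᵢ₎Kᵢ. Let P ∈ ℝ^{n×n} be symmetric positive definite and γ ≥ 0. If e ∈ ℝⁿ satisfies eᵀ M_Jᵀ P M_J e ≤ γ for every J ⊆ {1,…,m}, then for every v ∈ ℝᵐ with ‖v‖_∞ ≤ 1 we have f(e, v)ᵀ P f(e, v) ≤ γ. -/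
open Matrix

/-- Saturated error map: f(e, v) = A e + B (φ(K e + v) − v). -/
noncomputable def fSat {n m : ℕ} (A : Matrix (Fin n) (Fin n) ℝ)
    (B : Matrix (Fin n) (Fin m) ℝ) (K : Matrix (Fin m) (Fin n) ℝ)
    (e : Fin n → ℝ) (v : Fin m → ℝ) : Fin n → ℝ :=
  A.mulVec e + B.mulVec (sat (K.mulVec e + v) - v)

/-- M_J = A + Σ_{i∈J} B₍ᵢ₎ Kᵢ. -/
noncomputable def MJ {n m : ℕ} (A : Matrix (Fin n) (Fin n) ℝ)
    (B : Matrix (Fin n) (Fin m) ℝ) (K : Matrix (Fin m) (Fin n) ℝ)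
    (J : Finset (Fin m)) : Matrix (Fin n) (Fin n) ℝ :=
  A + ∑ i ∈ J, Matrix.vecMulVec (fun r => B r i) (K i)

/-- The increment of the saturation function after a perturbation `k` of a point `v ∈ [-1, 1]`
is a fraction `θ ∈ [0, 1]` of `k`. -/
theorem exists_sign_mul_min_sub_eq_mul (k v : ℝ) (hv : |v| ≤ 1) :
    ∃ θ : ℝ, 0 ≤ θ ∧ θ ≤ 1 ∧ Real.sign (k + v) * min |k + v| 1 - v = θ * k := by
  obtain ⟨hv₁, hv₂⟩ := abs_le.mp hv
  rcases lt_or_ge 1 (k + v) with h | h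
  · have hk : 0 < k := by linarith
    refine ⟨(1 - v) / k, div_nonneg (by linarith) hk.le, (div_le_one hk).2 (by linarith), ?_⟩
    rw [Real.sign_of_pos (by linarith), abs_of_pos (by linarith), min_eq_right h.le]
    field_simp
  rcases lt_or_ge (k + v) (-1) with h' | h'
  · have hk : k < 0 := by linarith
    refine ⟨(-1 - v) / k, div_nonneg_of_nonpos (by linarith) hk.le,
      (div_le_one_of_neg hk).2 (by linarith), ?_⟩
    rw [Real.sign_of_neg (by linarith), abs_of_neg (by linarith), min_eq_right (by linarith)]
    field_simp [hk.ne]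
  · refine ⟨1, zero_le_one, le_rfl, ?_⟩
    rw [min_eq_left (abs_le.2 ⟨h', h⟩)]
    rcases lt_trichotomy (k + v) 0 with h0 | h0 | h0
    · rw [Real.sign_of_neg h0, abs_of_neg h0]; ring
    · rw [h0, Real.sign_zero]; linarith
    · rw [Real.sign_of_pos h0, abs_of_pos h0]; ring

/-- A convex set containing the vertices `a + ∑ i ∈ J, w i` of a parallelotope contains
the whole parallelotope. -/
theorem Convex.add_sum_smul_mem {ι E : Type*} [AddCommGroup E] [Module ℝ E] {C : Set E}
    (hC : Convex ℝ C) (w : ι → E) (θ : ι → ℝ) (h0 : ∀ i, 0 ≤ θ i) (h1 : ∀ i, θ i ≤ 1)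
    (S : Finset ι) (a : E) (h : ∀ J ⊆ S, a + ∑ i ∈ J, w i ∈ C) :
    a + ∑ i ∈ S, θ i • w i ∈ C := by
  classical
  induction S using Finset.induction_on generalizing a with
  | empty => simpa using h ∅ subset_rfl
  | insert i S hi ih =>
    have hx := ih a fun J hJ => h J (hJ.trans (Finset.subset_insert i S))
    have hy := ih (a + w i) fun J hJ => by
      have := h (insert i J) (Finset.insert_subset_insert i hJ)
      rwa [Finset.sum_insert fun hiJ => hi (hJ hiJ), ← add_assoc] at this
    have := hC hx hy (sub_nonneg.2 (h1 i)) (h0 i) (by ring)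
    rw [Finset.sum_insert hi]
    convert this using 1
    module

/-- Sublevel sets of a positive semidefinite quadratic form are convex. -/
theorem Matrix.PosSemidef.convex_setOf_dotProduct_mulVec_le {n : Type*} [Fintype n]
    {P : Matrix n n ℝ} (hP : P.PosSemidef) (γ : ℝ) :
    Convex ℝ {x : n → ℝ | x ⬝ᵥ P.mulVec x ≤ γ} := by
  intro x hx y hy a b ha hb hab
  have hd : 0 ≤ (x - y) ⬝ᵥ P.mulVec (x - y) := by
    simpa using hP.dotProduct_mulVec_nonneg (x - y)
  simp only [Set.mem_ofPred_eq, mulVec_add, mulVec_sub, mulVec_smul, add_dotProduct,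
    sub_dotProduct, dotProduct_add, dotProduct_sub, smul_dotProduct, dotProduct_smul,
    smul_eq_mul] at *
  obtain rfl : b = 1 - a := by linarith
  nlinarith [mul_nonneg (mul_nonneg ha hb) hd, mul_le_mul_of_nonneg_left hx ha,
    mul_le_mul_of_nonneg_left hy hb]

theorem fSat_quadratic_bound {n m : ℕ} (A : Matrix (Fin n) (Fin n) ℝ)
    (B : Matrix (Fin n) (Fin m) ℝ) (K : Matrix (Fin m) (Fin n) ℝ)
    (P : Matrix (Fin n) (Fin n) ℝ) (hP : P.PosDef)
    (γ : ℝ) (hγ : 0 ≤ γ) (e : Fin n → ℝ)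
    (he : ∀ J : Finset (Fin m),
      ((MJ A B K J).mulVec e) ⬝ᵥ P.mulVec ((MJ A B K J).mulVec e) ≤ γ) :
    ∀ v : Fin m → ℝ, (∀ i, |v i| ≤ 1) →
      (fSat A B K e v) ⬝ᵥ P.mulVec (fSat A B K e v) ≤ γ := by
  intro v hv
  choose θ h0 h1 hθ using fun i => exists_sign_mul_min_sub_eq_mul (K.mulVec e i) (v i) (hv i)
  have hM : ∀ J : Finset (Fin m),
      (MJ A B K J).mulVec e = A.mulVec e + ∑ i ∈ J, K.mulVec e i • fun r => B r i := by
    intro J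
    rw [MJ, add_mulVec, sum_mulVec]
    congr 1
    refine Finset.sum_congr rfl fun i _ => ?_
    ext r
    rw [vecMulVec_mulVec]
    simp [mulVec, mul_comm]
  have hf : fSat A B K e v =
      A.mulVec e + ∑ i, θ i • (K.mulVec e i • fun r => B r i) := by
    rw [fSat]
    congr 1
    ext r
    rw [mulVec, dotProduct, Finset.sum_apply]
    refine Finset.sum_congr rfl fun i _ => ?_
    have : (sat (K.mulVec e + v) - v) i = θ i * K.mulVec e i := hθ i
    rw [this]
    simp only [Pi.smul_apply, smul_eq_mul]
    ring
  rw [hf]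
  refine (hP.posSemidef.convex_setOf_dotProduct_mulVec_le γ).add_sum_smul_mem
    (fun i => K.mulVec e i • fun r => B r i) θ h0 h1 Finset.univ (A.mulVec e) fun J _ => ?_
  simpa only [Set.mem_ofPred_eq, hM] using he J
end

section
/- Let P ∈ ℝ^{n×n} be symmetric positive definite, K ∈ ℝ^{m×n} with rows Kᵢ, and v ∈ ℝᵐ with ‖v‖_∞ ≤ 1. Define r_L = min over i ∈ {1,…,m} with Kᵢ ≠ 0 of (1 − |vᵢ|)²/(Kᵢ P⁻¹ Kᵢᵀ). Then for every e ∈ ℝⁿ with eᵀ P e ≤ r_L, one has |Kᵢ e + vᵢ| ≤ 1 for every i ∈ {1,…,m}; that is, the ellipsoid {e : eᵀ P e ≤ r_L} is contained in the region of linearity {e : ‖Ke + v‖_∞ ≤ 1}. -/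
open Matrix

/-- The Cauchy–Schwarz inequality for the inner product induced by a positive definite matrix,
in its dual form. -/
theorem Matrix.PosDef.sq_dotProduct_le {ι : Type*} [Fintype ι] [DecidableEq ι]
    {P : Matrix ι ι ℝ} (hP : P.PosDef) (k e : ι → ℝ) :
    (k ⬝ᵥ e) ^ 2 ≤ (k ⬝ᵥ P⁻¹.mulVec k) * (e ⬝ᵥ P.mulVec e) := by
  rcases eq_or_ne k 0 with rfl | hk
  · simp
  have hq : 0 < k ⬝ᵥ P⁻¹.mulVec k := by simpa using hP.inv.dotProduct_mulVec_pos hk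
  have hdet : IsUnit P.det := (Matrix.isUnit_iff_isUnit_det P).1 hP.isUnit
  have hPw : P.mulVec (P⁻¹.mulVec k) = k := by
    rw [Matrix.mulVec_mulVec, Matrix.mul_nonsing_inv P hdet, Matrix.one_mulVec]
  set w := P⁻¹.mulVec k
  have hsymm : w ⬝ᵥ P.mulVec e = k ⬝ᵥ e := by
    have hT : Pᵀ = P := by simpa using hP.isHermitian.eq
    rw [Matrix.dotProduct_mulVec, ← Matrix.mulVec_transpose, hT, hPw]
  have hx := hP.posSemidef.dotProduct_mulVec_nonneg ((k ⬝ᵥ w) • e - (k ⬝ᵥ e) • w)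
  simp only [star_trivial, Matrix.mulVec_sub, Matrix.mulVec_smul, hPw, sub_dotProduct,
    dotProduct_sub, smul_dotProduct, dotProduct_smul, smul_eq_mul, hsymm,
    dotProduct_comm e k, dotProduct_comm w k] at hx
  refine le_of_mul_le_mul_left ?_ hq
  linarith

theorem ellipsoid_in_region_of_linearity {n m : ℕ}
    (P : Matrix (Fin n) (Fin n) ℝ) (hP : P.PosDef)
    (K : Matrix (Fin m) (Fin n) ℝ) (v : Fin m → ℝ) (hv : ∀ i, |v i| ≤ 1)
    (rL : ℝ)
    (hrL : rL = ⨅ i : {i : Fin m // K i ≠ 0},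
      (1 - |v i.1|) ^ 2 / (K i.1 ⬝ᵥ P⁻¹.mulVec (K i.1))) :
    ∀ e : Fin n → ℝ, e ⬝ᵥ P.mulVec e ≤ rL →
      ∀ i, |K.mulVec e i + v i| ≤ 1 := by
  intro e he i
  change |K i ⬝ᵥ e + v i| ≤ 1
  by_cases hi : K i = 0
  · simpa [hi] using hv i
  have hq : 0 < K i ⬝ᵥ P⁻¹.mulVec (K i) := by simpa using hP.inv.dotProduct_mulVec_pos hi
  have hle : e ⬝ᵥ P.mulVec e ≤ (1 - |v i|) ^ 2 / (K i ⬝ᵥ P⁻¹.mulVec (K i)) :=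
    (he.trans hrL.le).trans (ciInf_le (Set.finite_range _).bddBelow (⟨i, hi⟩ : {i // K i ≠ 0}))
  rw [le_div_iff₀' hq] at hle
  have habs : |K i ⬝ᵥ e| ≤ 1 - |v i| :=
    abs_le_of_sq_le_sq ((hP.sq_dotProduct_le (K i) e).trans hle) (sub_nonneg.2 (hv i))
  linarith [abs_add_le (K i ⬝ᵥ e) (v i)]
end

section
/- Let c > 0, r_L > 0, and 0 ≤ λ_L < λ < 1 with c/(1 − λ) < r_L, and let λ̄* ∈ (λ_L, λ) be the unique solution of c/(1 − λ̄*) = ((λ̄* − λ_L)/(λ − λ_L))·r_L. Let (a_k)_{k∈ℕ} be a sequence of nonnegative reals with a_0 = 0 satisfying a_{k+1} ≤ λ_L a_k + ((λ − λ_L)/r_L)·a_k² + c for all k, and also a_{k+1} ≤ λ a_k + c for all k. Then a_k ≤ ((1 − (λ̄*)ᵏ)/(1 − λ̄*))·c for all k ∈ ℕ. -/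
theorem effective_rate_sequence_bound (c rL lamL lam lamBar : ℝ)
    (hc : 0 < c) (hrL : 0 < rL)
    (hlamL : 0 ≤ lamL) (hll : lamL < lam) (hlam : lam < 1)
    (hcond : c / (1 - lam) < rL)
    (hBarMem : lamBar ∈ Set.Ioo lamL lam)
    (hBarEq : c / (1 - lamBar) = ((lamBar - lamL) / (lam - lamL)) * rL)
    (a : ℕ → ℝ) (ha0 : a 0 = 0) (hnonneg : ∀ k, 0 ≤ a k)
    (hrec1 : ∀ k, a (k + 1) ≤ lamL * a k + ((lam - lamL) / rL) * (a k) ^ 2 + c)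
    (hrec2 : ∀ k, a (k + 1) ≤ lam * a k + c) :
    ∀ k, a k ≤ ((1 - lamBar ^ k) / (1 - lamBar)) * c := by
  obtain ⟨hL, hU⟩ := hBarMem
  have hd : 0 < lam - lamL := by linarith
  have h1 : 0 < 1 - lamBar := by linarith
  have hBar : 0 < lamBar := by linarith
  intro k
  induction k with
  | zero => simp [ha0]
  | succ k ih =>
    have hle : a k ≤ c / (1 - lamBar) := by
      refine ih.trans ?_
      rw [div_mul_eq_mul_div]
      gcongr
      nlinarith [pow_pos hBar k]
    have hslope : (lam - lamL) / rL * a k ≤ lamBar - lamL := by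
      calc (lam - lamL) / rL * a k ≤ (lam - lamL) / rL * (c / (1 - lamBar)) := by gcongr
        _ = lamBar - lamL := by
          rw [hBarEq]
          field_simp
    calc a (k + 1) ≤ lamL * a k + (lam - lamL) / rL * a k ^ 2 + c := hrec1 k
      _ = lamL * a k + (lam - lamL) / rL * a k * a k + c := by ring
      _ ≤ lamL * a k + (lamBar - lamL) * a k + c := by
        gcongr
        exact hnonneg k
      _ = lamBar * a k + c := by ring
      _ ≤ lamBar * ((1 - lamBar ^ k) / (1 - lamBar) * c) + c := by gcongr
      _ = (1 - lamBar ^ (k + 1)) / (1 - lamBar) * c := by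
        field_simp
        ring
end
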